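/- Let (P_t)_{t≥0} be a Feller, stochastically continuous Markov transition semigroup on a Polish metric space 𝒳 with the e-property. Fix ε > 0, a point z ∈ 𝒳, and a closed set C ⊆ 𝒳 possessing a finite (ε/2)-net, such that liminf_{T→∞} Q^T(z, C) > 1 − ε/2. Let C̃ := {x ∈ 𝒳 : dist(x, C) < ε/2}. Then there exists σ > 0 such that: (a) for every Borel probability measure ν supported in B(z,σ), liminf_{T→∞} Q^T ν(C̃) > 1 − 3ε/4; and (b) for any k ≥ 1 and t₁, …, t_k ≥ 0 there exists T* such that Q^{T,t₁,…,t_k} ν(C̃) > 1 − 3ε/4 for all T ≥ T* and all ν supported in B(z,σ), where Q^{T,t₁,…,t_k}ν := Q^T(Q^{t₁}(⋯(Q^{t_k}ν)⋯)). -/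

import Mathlib

open MeasureTheory Filter Topology Metric Set

noncomputable section

/-- A Markov transition semigroup on a measurable space `X`: a jointly measurable family
of Markov probability kernels `P t x` with `P 0 x = δ_x` and the Chapman–Kolmogorov
semigroup property for nonnegative times. -/
structure MarkovSemigroup (X : Type*) [MeasurableSpace X] where
  P : ℝ → X → MeasureTheory.Measure X
  prob : ∀ t x, MeasureTheory.IsProbabilityMeasure (P t x)
  meas : Measurable fun p : ℝ × X => P p.1 p.2
  init : ∀ x : X, P 0 x = MeasureTheory.Measure.dirac x
  semigroup : ∀ t s : ℝ, 0 ≤ t → 0 ≤ s → ∀ x : X,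
    P (t + s) x = (P t x).bind (P s)

namespace MarkovSemigroup

variable {X : Type*} [MeasurableSpace X]

/-- Action `P_t f(x) = ∫ f(y) P_t(x,dy)` on functions. -/
def act (M : MarkovSemigroup X) (t : ℝ) (f : X → ℝ) (x : X) : ℝ :=
  ∫ y, f y ∂(M.P t x)

/-- Dual action `P_t^* μ` on measures. -/
def dual (M : MarkovSemigroup X) (t : ℝ) (μ : MeasureTheory.Measure X) :
    MeasureTheory.Measure X :=
  μ.bind (M.P t)

/-- The time average `Q^T μ = (1/T) ∫_0^T P_s^* μ ds` (with the convention
`Q^T μ = μ` for `T ≤ 0`). -/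
def QM (M : MarkovSemigroup X) (T : ℝ) (μ : MeasureTheory.Measure X) :
    MeasureTheory.Measure X :=
  if T ≤ 0 then μ
  else ((ENNReal.ofReal (1 / T)) • (volume.restrict (Set.Ioc (0 : ℝ) T))).bind
    fun s => M.dual s μ

/-- `Q^T(x,·) := Q^T δ_x`. -/
def Q (M : MarkovSemigroup X) (T : ℝ) (x : X) : MeasureTheory.Measure X :=
  M.QM T (MeasureTheory.Measure.dirac x)

/-- Iterated averages: for `ts = [t_k, …, t_1]`, `QMs ts μ = Q^{t_k}(⋯(Q^{t_1} μ)⋯)`. -/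
def QMs (M : MarkovSemigroup X) (ts : List ℝ) (μ : MeasureTheory.Measure X) :
    MeasureTheory.Measure X :=
  ts.foldr (fun t ν => M.QM t ν) μ

/-- A measure is invariant if `P_t^* μ = μ` for all `t ≥ 0`. -/
def Invariant (M : MarkovSemigroup X) (μ : MeasureTheory.Measure X) : Prop :=
  ∀ t : ℝ, 0 ≤ t → M.dual t μ = μ

section TopologicalDefs

variable [TopologicalSpace X]

/-- Bounded continuous real functions. -/
def IsBddContinuous (f : X → ℝ) : Prop :=
  Continuous f ∧ ∃ C : ℝ, ∀ x, |f x| ≤ C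

/-- The Feller property: `P_t` maps bounded continuous functions to continuous ones. -/
def Feller (M : MarkovSemigroup X) : Prop :=
  ∀ t : ℝ, 0 ≤ t → ∀ f : X → ℝ, MarkovSemigroup.IsBddContinuous f →
    Continuous (M.act t f)

/-- Stochastic continuity: `P_t f(x) → f(x)` as `t → 0+`. -/
def StochasticallyContinuous (M : MarkovSemigroup X) : Prop :=
  ∀ f : X → ℝ, MarkovSemigroup.IsBddContinuous f → ∀ x : X,
    Filter.Tendsto (fun t : ℝ => M.act t f x) (nhdsWithin 0 (Set.Ioi 0)) (nhds (f x))

/-- Weak convergence of `Q^T ν` to `μ` as `T → ∞`. -/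
def QTendsto (M : MarkovSemigroup X) (ν μ : MeasureTheory.Measure X) : Prop :=
  ∀ f : X → ℝ, MarkovSemigroup.IsBddContinuous f →
    Filter.Tendsto (fun T : ℝ => ∫ x, f x ∂(M.QM T ν)) Filter.atTop
      (nhds (∫ x, f x ∂μ))

/-- Weak-* mean ergodicity with limit `μstar`. -/
def WeakStarMeanErgodic (M : MarkovSemigroup X) (μstar : MeasureTheory.Measure X) : Prop :=
  ∀ ν : MeasureTheory.Measure X, MeasureTheory.IsProbabilityMeasure ν → M.QTendsto ν μstar

/-- Tightness of the family `(Q^T(x,·))_{T>0}`. -/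
def TightAt (M : MarkovSemigroup X) (x : X) : Prop :=
  ∀ ε : ℝ, 0 < ε → ∃ K : Set X, IsCompact K ∧
    ∀ T : ℝ, 0 < T → 1 - ε ≤ ((M.Q T x) K).toReal

end TopologicalDefs

end MarkovSemigroup

/-- Topological support of a measure: points all of whose open neighborhoods
have positive mass. -/
def msupport {X : Type*} [MeasurableSpace X] [TopologicalSpace X]
    (μ : MeasureTheory.Measure X) : Set X :=
  {x : X | ∀ U : Set X, IsOpen U → x ∈ U → 0 < μ U}

/-- Total variation distance between two (finite) measures, as the supremum over
Borel sets of the discrepancy of masses. -/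
def tvDist {X : Type*} [MeasurableSpace X] (μ ν : MeasureTheory.Measure X) : ℝ :=
  ⨆ B : {B : Set X // MeasurableSet B}, |(μ B.1).toReal - (ν B.1).toReal|

section MetricDefs

variable {X : Type*} [MeasurableSpace X] [PseudoMetricSpace X]

/-- Bounded Lipschitz real functions. -/
def IsBddLipschitz (ψ : X → ℝ) : Prop :=
  (∃ K : NNReal, LipschitzWith K ψ) ∧ ∃ C : ℝ, ∀ x, |ψ x| ≤ C

/-- The e-property: equicontinuity of `(P_t ψ)_{t ≥ 0}` at every point, for every
bounded Lipschitz `ψ`. -/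
def MarkovSemigroup.EProperty (M : MarkovSemigroup X) : Prop :=
  ∀ ψ : X → ℝ, IsBddLipschitz ψ → ∀ x : X, ∀ ε : ℝ, 0 < ε →
    ∃ δ : ℝ, 0 < δ ∧ ∀ z : X, dist z x < δ → ∀ t : ℝ, 0 ≤ t →
      |M.act t ψ z - M.act t ψ x| < ε

end MetricDefs

open scoped ENNReal

namespace MarkovSemigroup

variable {X : Type*} [MeasurableSpace X] (M : MarkovSemigroup X)

lemma measurable_P (t : ℝ) : Measurable (M.P t) :=
  M.meas.comp measurable_prodMk_left

lemma lintegral_dual (t : ℝ) (μ : Measure X) {f : X → ℝ≥0∞} (hf : Measurable f) :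
    ∫⁻ y, f y ∂(M.dual t μ) = ∫⁻ x, ∫⁻ y, f y ∂(M.P t x) ∂μ :=
  Measure.lintegral_bind (M.measurable_P t).aemeasurable hf.aemeasurable

lemma isProbabilityMeasure_dual (t : ℝ) (μ : Measure X) [IsProbabilityMeasure μ] :
    IsProbabilityMeasure (M.dual t μ) := by
  have := M.prob t
  constructor
  rw [dual, Measure.bind_apply .univ (M.measurable_P t).aemeasurable]
  simp

lemma measurable_dual (μ : Measure X) [SFinite μ] : Measurable fun s => M.dual s μ := by
  refine Measure.measurable_of_measurable_coe _ fun B hB => ?_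
  have h : Measurable fun s => ∫⁻ x, M.P s x B ∂μ :=
    Measurable.lintegral_prod_right' (f := fun p : ℝ × X => M.P p.1 p.2 B)
      ((Measure.measurable_coe hB).comp M.meas)
  convert h using 2 with s
  exact Measure.bind_apply hB (M.measurable_P s).aemeasurable

lemma dual_dual {t s : ℝ} (ht : 0 ≤ t) (hs : 0 ≤ s) (μ : Measure X) :
    M.dual s (M.dual t μ) = M.dual (t + s) μ := by
  rw [dual, dual, Measure.bind_bind (M.measurable_P t).aemeasurable
    (M.measurable_P s).aemeasurable, dual]
  congr 1
  funext x
  exact (M.semigroup t s ht hs x).symm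

lemma lintegral_QM {T : ℝ} (hT : 0 < T) (μ : Measure X) [SFinite μ] {f : X → ℝ≥0∞}
    (hf : Measurable f) :
    ∫⁻ y, f y ∂(M.QM T μ) =
      ENNReal.ofReal (1 / T) * ∫⁻ s in Ioc 0 T, ∫⁻ y, f y ∂(M.dual s μ) := by
  rw [QM, if_neg hT.not_ge, Measure.lintegral_bind (M.measurable_dual μ).aemeasurable
    hf.aemeasurable, lintegral_smul_measure, smul_eq_mul]

lemma QM_apply {T : ℝ} (hT : 0 < T) (μ : Measure X) [SFinite μ] {B : Set X}
    (hB : MeasurableSet B) :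
    M.QM T μ B = ENNReal.ofReal (1 / T) * ∫⁻ s in Ioc 0 T, M.dual s μ B := by
  simpa [lintegral_indicator_one hB] using
    M.lintegral_QM hT μ (f := B.indicator 1) (measurable_one.indicator hB)

lemma ofReal_one_div_mul_ofReal {T : ℝ} (hT : 0 < T) (a : ℝ) :
    ENNReal.ofReal (1 / T) * ENNReal.ofReal a = ENNReal.ofReal (a / T) := by
  rw [← ENNReal.ofReal_mul (by positivity)]
  congr 1
  ring

lemma ofReal_one_div_mul_self {T : ℝ} (hT : 0 < T) :
    ENNReal.ofReal (1 / T) * ENNReal.ofReal T = 1 := by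
  rw [ofReal_one_div_mul_ofReal hT, div_self hT.ne', ENNReal.ofReal_one]

lemma isProbabilityMeasure_QM (T : ℝ) (μ : Measure X) [IsProbabilityMeasure μ] :
    IsProbabilityMeasure (M.QM T μ) := by
  by_cases hT : T ≤ 0
  · rw [QM, if_pos hT]
    infer_instance
  · have := fun s => M.isProbabilityMeasure_dual s μ
    constructor
    rw [M.QM_apply (not_le.1 hT) μ .univ]
    simp [ofReal_one_div_mul_self (not_le.1 hT), -one_div]

lemma isProbabilityMeasure_QMs (ts : List ℝ) (μ : Measure X) [IsProbabilityMeasure μ] :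
    IsProbabilityMeasure (M.QMs ts μ) := by
  induction ts with
  | nil => simpa [QMs]
  | cons t ts ih => exact M.isProbabilityMeasure_QM t (M.QMs ts μ)

/-- A time shift by `u` changes the time average over `(0, T]` by at most `u / T`. -/
lemma QM_le_shift_add {T u : ℝ} (hT : 0 < T) (hu : 0 ≤ u) (μ : Measure X)
    [IsProbabilityMeasure μ] {B : Set X} (hB : MeasurableSet B) :
    M.QM T μ B ≤ ENNReal.ofReal (1 / T) * (∫⁻ v in Ioc 0 T, M.dual (u + v) μ B)
      + ENNReal.ofReal (u / T) := by
  have := fun s => M.isProbabilityMeasure_dual s μ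
  have hg : Measurable fun s => M.dual s μ B :=
    (Measure.measurable_coe hB).comp (M.measurable_dual μ)
  have hshift : ∫⁻ v in Ioc 0 T, M.dual (u + v) μ B = ∫⁻ r in Ioc u (u + T), M.dual r μ B := by
    have h := (measurePreserving_add_left volume u).setLIntegral_comp_preimage
      (s := Ioc u (u + T)) measurableSet_Ioc hg
    simpa using h
  have hstart : ∫⁻ r in Ioc 0 u, M.dual r μ B ≤ ENNReal.ofReal u := by
    calc ∫⁻ r in Ioc 0 u, M.dual r μ B ≤ ∫⁻ _ in Ioc 0 u, 1 :=
          lintegral_mono fun r => prob_le_one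
      _ = ENNReal.ofReal u := by simp
  rw [M.QM_apply hT μ hB, ← ofReal_one_div_mul_ofReal hT u, ← mul_add, hshift]
  gcongr
  calc ∫⁻ r in Ioc 0 T, M.dual r μ B ≤ ∫⁻ r in Ioc u (u + T) ∪ Ioc 0 u, M.dual r μ B := by
        refine lintegral_mono_set fun r hr => ?_
        rcases le_or_gt r u with h | h
        · exact .inr ⟨hr.1, h⟩
        · exact .inl ⟨h, by linarith [hr.2]⟩
    _ ≤ _ := (lintegral_union_le _ _ _).trans (by gcongr)

lemma QM_le_QM_QM_add {T t : ℝ} (hT : 0 < T) (ht : 0 ≤ t) (μ : Measure X)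
    [IsProbabilityMeasure μ] {B : Set X} (hB : MeasurableSet B) :
    M.QM T μ B ≤ M.QM T (M.QM t μ) B + ENNReal.ofReal (t / T) := by
  rcases ht.eq_or_lt with rfl | ht
  · simp [QM]
  have := M.isProbabilityMeasure_QM t μ
  have hg : Measurable fun s => M.dual s μ B :=
    (Measure.measurable_coe hB).comp (M.measurable_dual μ)
  have hdual : ∀ v ∈ Ioc 0 T, M.dual v (M.QM t μ) B =
      ENNReal.ofReal (1 / t) * ∫⁻ u in Ioc 0 t, M.dual (u + v) μ B := by
    intro v hv
    have hPB : Measurable fun x => M.P v x B :=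
      (Measure.measurable_coe hB).comp (M.measurable_P v)
    rw [dual, Measure.bind_apply hB (M.measurable_P v).aemeasurable, M.lintegral_QM ht μ hPB]
    congr 1
    refine setLIntegral_congr_fun measurableSet_Ioc fun u hu => ?_
    rw [← M.dual_dual hu.1.le hv.1.le]
    exact (Measure.bind_apply hB (M.measurable_P v).aemeasurable).symm
  have hswap : M.QM T (M.QM t μ) B = ENNReal.ofReal (1 / t) * ∫⁻ u in Ioc 0 t,
      ENNReal.ofReal (1 / T) * ∫⁻ v in Ioc 0 T, M.dual (u + v) μ B := by
    rw [M.QM_apply hT _ hB, setLIntegral_congr_fun measurableSet_Ioc hdual,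
      lintegral_const_mul' _ _ ENNReal.ofReal_ne_top,
      lintegral_const_mul' _ _ ENNReal.ofReal_ne_top, lintegral_lintegral_swap, mul_left_comm]
    exact (hg.comp (measurable_snd.add measurable_fst)).aemeasurable
  calc M.QM T μ B = ENNReal.ofReal (1 / t) * ∫⁻ _ in Ioc 0 t, M.QM T μ B := by
        rw [setLIntegral_const, Real.volume_Ioc, sub_zero, mul_left_comm,
          ofReal_one_div_mul_self ht, mul_one]
    _ ≤ ENNReal.ofReal (1 / t) * ∫⁻ u in Ioc 0 t,
          (ENNReal.ofReal (1 / T) * (∫⁻ v in Ioc 0 T, M.dual (u + v) μ B)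
            + ENNReal.ofReal (t / T)) := by
        refine mul_le_mul_right (setLIntegral_mono' measurableSet_Ioc fun u hu => ?_) _
        refine (M.QM_le_shift_add hT hu.1.le μ hB).trans ?_
        gcongr
        exact hu.2
    _ = M.QM T (M.QM t μ) B + ENNReal.ofReal (t / T) := by
        rw [lintegral_add_right _ measurable_const, mul_add, ← hswap, setLIntegral_const,
          Real.volume_Ioc, sub_zero, mul_left_comm, ofReal_one_div_mul_self ht, mul_one]

lemma QM_le_QM_QMs_add {T : ℝ} (hT : 0 < T) (ts : List ℝ) (hts : ∀ t ∈ ts, 0 ≤ t)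
    (μ : Measure X) [IsProbabilityMeasure μ] {B : Set X} (hB : MeasurableSet B) :
    M.QM T μ B ≤ M.QM T (M.QMs ts μ) B + ENNReal.ofReal (ts.sum / T) := by
  induction ts with
  | nil => simp [QMs]
  | cons t ts ih =>
    rw [List.forall_mem_cons] at hts
    have := M.isProbabilityMeasure_QMs ts μ
    calc M.QM T μ B ≤ M.QM T (M.QMs ts μ) B + ENNReal.ofReal (ts.sum / T) := ih hts.2
      _ ≤ M.QM T (M.QM t (M.QMs ts μ)) B + ENNReal.ofReal (t / T)
            + ENNReal.ofReal (ts.sum / T) := by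
          gcongr
          exact M.QM_le_QM_QM_add hT hts.1 _ hB
      _ = M.QM T (M.QMs (t :: ts) μ) B + ENNReal.ofReal ((t :: ts).sum / T) := by
          rw [add_assoc, ← ENNReal.ofReal_add (div_nonneg hts.1 hT.le)
            (div_nonneg (List.sum_nonneg hts.2) hT.le), List.sum_cons, add_div]
          rfl

/-- If `P_s f` at `z` exceeds `P_s f` by at most `a` throughout a set carrying `ν`, uniformly in
`s ≥ 0`, then the same holds for the averages started from `z` and from `ν`. -/
lemma lintegral_Q_le_lintegral_QM_add {T : ℝ} (hT : 0 < T) {z : X} {a : ℝ≥0∞} (ν : Measure X)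
    [IsProbabilityMeasure ν] {f : X → ℝ≥0∞} (hf : Measurable f)
    (h : ∀ s, 0 ≤ s → ∀ᵐ x ∂ν, ∫⁻ y, f y ∂(M.P s z) ≤ ∫⁻ y, f y ∂(M.P s x) + a) :
    ∫⁻ y, f y ∂(M.Q T z) ≤ ∫⁻ y, f y ∂(M.QM T ν) + a := by
  have hs : ∀ s ∈ Ioc 0 T, ∫⁻ y, f y ∂(M.dual s (Measure.dirac z)) ≤
      ∫⁻ y, f y ∂(M.dual s ν) + a := by
    intro s hs
    have hPf : Measurable fun x => ∫⁻ y, f y ∂(M.P s x) :=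
      (Measure.measurable_lintegral hf).comp (M.measurable_P s)
    rw [M.lintegral_dual s _ hf, M.lintegral_dual s _ hf, lintegral_dirac' z hPf]
    calc ∫⁻ y, f y ∂(M.P s z) = ∫⁻ _, ∫⁻ y, f y ∂(M.P s z) ∂ν := by simp
      _ ≤ ∫⁻ x, (∫⁻ y, f y ∂(M.P s x) + a) ∂ν := lintegral_mono_ae (h s hs.1.le)
      _ = _ := by rw [lintegral_add_right _ measurable_const]; simp
  rw [Q, M.lintegral_QM hT _ hf, M.lintegral_QM hT _ hf]
  calc _ ≤ ENNReal.ofReal (1 / T) * ∫⁻ s in Ioc 0 T, (∫⁻ y, f y ∂(M.dual s ν) + a) := by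
        gcongr 1
        exact setLIntegral_mono' measurableSet_Ioc hs
    _ = _ := by
        rw [lintegral_add_right _ measurable_const, mul_add, setLIntegral_const, Real.volume_Ioc,
          sub_zero, mul_left_comm, ofReal_one_div_mul_self hT, mul_one]

end MarkovSemigroup

lemma isBddLipschitz_max_zero_one_sub_infDist {X : Type*} [MeasurableSpace X]
    [PseudoMetricSpace X] (C : Set X) {δ : ℝ} (hδ : 0 < δ) :
    IsBddLipschitz fun x => max 0 (1 - infDist x C / δ) := by
  constructor
  · refine ⟨(1 / δ).toNNReal, LipschitzWith.const_max (LipschitzWith.of_dist_le_mul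
      fun x y => ?_) 0⟩
    rw [Real.dist_eq, Real.coe_toNNReal _ (by positivity), sub_sub_sub_cancel_left, ← sub_div,
      abs_div, abs_of_pos hδ, one_div, inv_mul_eq_div, ← Real.dist_eq, dist_comm]
    gcongr
    simpa using (lipschitz_infDist_pt C).dist_le_mul x y
  · refine ⟨1, fun x => ?_⟩
    have : 0 ≤ infDist x C / δ := div_nonneg infDist_nonneg hδ.le
    rw [abs_of_nonneg (le_max_left _ _)]
    exact max_le zero_le_one (by linarith)

/-- Under the e-property, the averages of `C` started from `z` are bounded by the averages of a
thickening of `C` started from any probability measure concentrated near `z`, up to a small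
error. -/
lemma MarkovSemigroup.EProperty.exists_forall_Q_le_QM_thickening_add {X : Type*}
    [PseudoMetricSpace X] [MeasurableSpace X] [BorelSpace X] {M : MarkovSemigroup X} (hE : M.EProperty) (z : X)
    (C : Set X) {δ η : ℝ} (hδ : 0 < δ) (hη : 0 < η) :
    ∃ σ : ℝ, 0 < σ ∧ ∀ ν : Measure X, IsProbabilityMeasure ν → ν (ball z σ) = 1 →
      ∀ T : ℝ, 0 < T → M.Q T z C ≤ M.QM T ν (thickening δ C) + ENNReal.ofReal η := by
  rcases C.eq_empty_or_nonempty with rfl | hC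
  · exact ⟨1, one_pos, fun ν _ _ T _ => by simp⟩
  set ψ : X → ℝ := fun x => max 0 (1 - infDist x C / δ) with hψ
  have hψL : IsBddLipschitz ψ := isBddLipschitz_max_zero_one_sub_infDist C hδ
  have hψ0 : ∀ x, 0 ≤ ψ x := fun x => le_max_left _ _
  have hψm : Measurable ψ := hψL.1.choose_spec.continuous.measurable
  have hact : ∀ s x, ENNReal.ofReal (M.act s ψ x) = ∫⁻ y, ENNReal.ofReal (ψ y) ∂(M.P s x) := by
    intro s x
    have := M.prob s x
    obtain ⟨b, hb⟩ := hψL.2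
    exact ofReal_integral_eq_lintegral_ofReal
      (.of_bound hψm.aestronglyMeasurable b (.of_forall hb)) (.of_forall hψ0)
  obtain ⟨σ, hσ, hclose⟩ := hE ψ hψL z η hη
  refine ⟨σ, hσ, fun ν _ hν T hT => ?_⟩
  have hmain := M.lintegral_Q_le_lintegral_QM_add hT (z := z) (a := ENNReal.ofReal η) ν
    hψm.ennreal_ofReal fun s hs => by
      filter_upwards [(prob_compl_eq_zero_iff isOpen_ball.measurableSet).2 hν] with x hx
      rw [← hact, ← hact]
      refine (ENNReal.ofReal_le_ofReal ?_).trans ENNReal.ofReal_add_le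
      linarith [(abs_lt.1 (hclose x hx s hs)).1]
  refine (le_trans ?_ hmain).trans (add_le_add_left ?_ _)
  · refine (measure_mono subset_closure).trans ?_
    rw [← lintegral_indicator_one isClosed_closure.measurableSet]
    refine lintegral_mono fun x => indicator_le (s := closure C) (f := 1)
      (g := fun x => ENNReal.ofReal (ψ x)) (fun x hx => ?_) x
    have : infDist x C = 0 := (mem_closure_iff_infDist_zero hC).1 hx
    simp [hψ, this]
  · rw [← lintegral_indicator_one isOpen_thickening.measurableSet]
    refine lintegral_mono fun x => ?_
    by_cases hx : x ∈ thickening δ C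
    · have : 0 ≤ infDist x C / δ := div_nonneg infDist_nonneg hδ.le
      simpa [hx, hψ] using this
    · rw [mem_thickening_iff_infDist_lt hC, not_lt] at hx
      have : 1 ≤ infDist x C / δ := (one_le_div hδ).2 hx
      simp [hψ, this]

/-- Lemma 4 of the paper. For a Feller, stochastically continuous
semigroup with the e-property, if `C` is a closed set with a finite `(ε/2)`-net whose
ergodic averages from `z` eventually exceed `1 − ε/2`, then there is `σ > 0` such that
for every probability measure `ν` supported in `B(z,σ)`: (a) the ergodic averages of
the `(ε/2)`-neighborhood `C̃` of `C` are asymptotically larger than `1 − 3ε/4`, and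
(b) uniformly so after any fixed string of extra averagings `Q^{t₁},…,Q^{t_k}`. -/
theorem uniform_ergodic_lower_bound_near_point
    {X : Type*} [MetricSpace X] [CompleteSpace X] [SecondCountableTopology X]
    [MeasurableSpace X] [BorelSpace X]
    (M : MarkovSemigroup X)
    (hFeller : M.Feller) (hSC : M.StochasticallyContinuous) (hE : M.EProperty)
    (ε : ℝ) (hε : 0 < ε) (z : X)
    (C : Set X) (hCclosed : IsClosed C)
    (hCnet : ∃ s : Finset X, C ⊆ ⋃ x ∈ s, Metric.ball x (ε / 2))
    (hCz : 1 - ε / 2 <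
      Filter.liminf (fun T : ℝ => ((M.Q T z) C).toReal) Filter.atTop) :
    ∃ σ : ℝ, 0 < σ ∧
      (∀ ν : MeasureTheory.Measure X, MeasureTheory.IsProbabilityMeasure ν →
        ν (Metric.ball z σ) = 1 →
        1 - 3 * ε / 4 <
          Filter.liminf
            (fun T : ℝ => ((M.QM T ν) (Metric.thickening (ε / 2) C)).toReal)
            Filter.atTop) ∧
      (∀ ts : List ℝ, ts ≠ [] → (∀ t ∈ ts, (0 : ℝ) ≤ t) →
        ∃ Tstar : ℝ, ∀ T : ℝ, Tstar ≤ T →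
          ∀ ν : MeasureTheory.Measure X, MeasureTheory.IsProbabilityMeasure ν →
            ν (Metric.ball z σ) = 1 →
            1 - 3 * ε / 4 <
              ((M.QM T (M.QMs ts ν)) (Metric.thickening (ε / 2) C)).toReal) := by
  obtain ⟨σ, hσ, hbound⟩ := hE.exists_forall_Q_le_QM_thickening_add z C
    (half_pos hε) (η := ε / 8) (by positivity)
  have hQ : ∀ᶠ T in atTop, 1 - ε / 2 < ((M.Q T z) C).toReal :=
    eventually_lt_of_lt_liminf hCz
      (isBoundedUnder_of ⟨0, fun _ => ENNReal.toReal_nonneg⟩)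
  have key : ∀ ts : List ℝ, (∀ t ∈ ts, (0 : ℝ) ≤ t) → ∀ᶠ T in atTop,
      ∀ ν : Measure X, IsProbabilityMeasure ν → ν (ball z σ) = 1 →
        1 - 11 * ε / 16 < ((M.QM T (M.QMs ts ν)) (thickening (ε / 2) C)).toReal := by
    intro ts hts
    filter_upwards [hQ, eventually_gt_atTop 0, eventually_ge_atTop (ts.sum / (ε / 16))]
      with T hTQ hT hTs ν hν hνσ
    have hsum : ts.sum / T ≤ ε / 16 := by
      rw [div_le_iff₀ (by positivity)] at hTs
      rw [div_le_iff₀ hT]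
      linarith
    have := M.isProbabilityMeasure_QMs ts ν
    have := M.isProbabilityMeasure_QM T (M.QMs ts ν)
    have hle : M.Q T z C ≤ M.QM T (M.QMs ts ν) (thickening (ε / 2) C)
        + ENNReal.ofReal (ε / 16) + ENNReal.ofReal (ε / 8) := by
      refine (hbound ν hν hνσ T hT).trans ?_
      gcongr
      refine (M.QM_le_QM_QMs_add hT ts hts ν isOpen_thickening.measurableSet).trans ?_
      gcongr
    have hreal := ENNReal.toReal_mono (by finiteness) hle
    rw [ENNReal.toReal_add (by finiteness) (by finiteness),
      ENNReal.toReal_add (by finiteness) (by finiteness),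
      ENNReal.toReal_ofReal (by positivity), ENNReal.toReal_ofReal (by positivity)] at hreal
    linarith
  refine ⟨σ, hσ, fun ν hν hνσ => ?_, fun ts _ hts => ?_⟩
  · have hprob := fun T => M.isProbabilityMeasure_QM T ν
    refine lt_of_lt_of_le (b := 1 - 11 * ε / 16) (by linarith) (le_liminf_of_le ?_ ?_)
    · exact IsBoundedUnder.isCoboundedUnder_ge
        (isBoundedUnder_of ⟨1, fun T => measureReal_le_one⟩)
    · filter_upwards [key [] (by simp)] with T hT
      exact (hT ν hν hνσ).le
  · obtain ⟨Tstar, hTstar⟩ := eventually_atTop.1 (key ts hts)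
    exact ⟨Tstar, fun T hT ν hν hνσ => by linarith [hTstar T hT ν hν hνσ]⟩
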